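/- Let n ∈ ℕ, p ∈ [0,1], q = 1−p, θ ∈ [0,1]. Let S ~ Binomial(n,p) and let X be an independent exponential random variable with rate λ satisfying 0 < λ ≤ 1 and λ ≤ 1/√(p·q·n) (vacuous if p·q·n = 0). Let B be the event {S + X > θ·n} and assume Pr[B] < 1/4. Then there is a universal constant C > 0 such that the KL-divergence of the conditional law of S given the complement of B from the law of S satisfies d_{KL}((S | ¬B), S) ≤ C · (Pr[B] · √(p·q·n) · λ)². -/

import Mathlib

/-- `Pr[S = k]` for `S ~ Binomial(n, p)`. -/
noncomputable def binomPMF (n : ℕ) (p : ℝ) (k : ℕ) : ℝ :=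
  (n.choose k : ℝ) * p ^ k * (1 - p) ^ (n - k)

/-- `Pr[X > t]` for `X` an exponential random variable with rate `lam > 0`. -/
noncomputable def expTail (lam t : ℝ) : ℝ :=
  if t ≤ 0 then 1 else Real.exp (-(lam * t))

/-- `Pr[S + X > θ·n]` for `S ~ Binomial(n, p)` and `X ~ Exponential(lam)` independent. -/
noncomputable def prAbove (n : ℕ) (p θ lam : ℝ) : ℝ :=
  ∑ k ∈ Finset.range (n + 1), binomPMF n p k * expTail lam (θ * n - k)

/-- The conditional law of `S` given the complement of `{S + X > θ·n}`. -/
noncomputable def condPMF (n : ℕ) (p θ lam : ℝ) (k : ℕ) : ℝ :=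
  binomPMF n p k * (1 - expTail lam (θ * n - k)) / (1 - prAbove n p θ lam)

theorem binomPMF_nonneg (n : ℕ) {p : ℝ} (hp0 : 0 ≤ p) (hp1 : p ≤ 1) (k : ℕ) :
    0 ≤ binomPMF n p k := by
  have h : 0 ≤ 1 - p := by linarith
  unfold binomPMF
  positivity

theorem sum_binomPMF (n : ℕ) (p : ℝ) : ∑ k ∈ Finset.range (n + 1), binomPMF n p k = 1 := by
  have h := add_pow p (1 - p) n
  rw [add_sub_cancel, one_pow] at h
  rw [h]
  refine Finset.sum_congr rfl fun k _ => ?_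
  unfold binomPMF
  ring

/-- The moment generating function of the centred binomial distribution. -/
theorem sum_binomPMF_mul_exp (n : ℕ) (p s : ℝ) :
    ∑ k ∈ Finset.range (n + 1), binomPMF n p k * Real.exp (s * (k - n * p)) =
      (p * Real.exp (s * (1 - p)) + (1 - p) * Real.exp (-(s * p))) ^ n := by
  rw [add_pow]
  refine Finset.sum_congr rfl fun k hk => ?_
  have hkn : k ≤ n := Nat.lt_succ_iff.mp (Finset.mem_range.mp hk)
  have he : Real.exp (s * (k - n * p)) =
      Real.exp (s * (1 - p)) ^ k * Real.exp (-(s * p)) ^ (n - k) := by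
    rw [← Real.exp_nat_mul, ← Real.exp_nat_mul, ← Real.exp_add, Nat.cast_sub hkn]
    congr 1
    ring
  rw [he, mul_pow, mul_pow]
  unfold binomPMF
  ring

theorem exp_le_one_add_add_two_mul_sq {x : ℝ} (hx : |x| ≤ 2) :
    Real.exp x ≤ 1 + x + 2 * x ^ 2 := by
  obtain ⟨h1, h2⟩ := abs_le.mp hx
  have hy : |x / 2| ≤ 1 := abs_le.mpr ⟨by linarith, by linarith⟩
  have h3 := (abs_le.mp (Real.abs_exp_sub_one_sub_id_le hy)).2
  have h4 : Real.exp x = Real.exp (x / 2) ^ 2 := by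
    rw [← Real.exp_nat_mul]
    congr 1
    push_cast
    ring
  have h5 : Real.exp (x / 2) ^ 2 ≤ (1 + x / 2 + (x / 2) ^ 2) ^ 2 :=
    pow_le_pow_left₀ (Real.exp_pos _).le (by linarith) 2
  have h6 : 0 ≤ (2 - x) * (2 + x) := mul_nonneg (by linarith) (by linarith)
  have h7 : 0 ≤ x ^ 2 * (2 - x) := mul_nonneg (sq_nonneg x) (by linarith)
  have h8 : 0 ≤ x ^ 2 * ((2 - x) * (2 + x)) := mul_nonneg (sq_nonneg x) h6
  rw [h4]
  nlinarith [sq_nonneg x]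

theorem one_le_sum_binomPMF_mul_exp (n : ℕ) {p : ℝ} (hp0 : 0 ≤ p) (hp1 : p ≤ 1) (s : ℝ) :
    1 ≤ ∑ k ∈ Finset.range (n + 1), binomPMF n p k * Real.exp (s * (k - n * p)) := by
  rw [sum_binomPMF_mul_exp]
  refine one_le_pow₀ ?_
  have h1 := mul_le_mul_of_nonneg_left (Real.add_one_le_exp (s * (1 - p))) hp0
  have h2 := mul_le_mul_of_nonneg_left (Real.add_one_le_exp (-(s * p))) (sub_nonneg.mpr hp1)
  linarith

theorem sum_binomPMF_mul_exp_le (n : ℕ) {p s : ℝ} (hp0 : 0 ≤ p) (hp1 : p ≤ 1) (hs : |s| ≤ 2) :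
    ∑ k ∈ Finset.range (n + 1), binomPMF n p k * Real.exp (s * (k - n * p)) ≤
      Real.exp (2 * s ^ 2 * (p * (1 - p) * n)) := by
  have hq0 : 0 ≤ 1 - p := sub_nonneg.mpr hp1
  have e1 : |s * (1 - p)| ≤ 2 := by
    rw [abs_mul, abs_of_nonneg hq0]
    nlinarith [abs_nonneg s]
  have e2 : |-(s * p)| ≤ 2 := by
    rw [abs_neg, abs_mul, abs_of_nonneg hp0]
    nlinarith [abs_nonneg s]
  have h1 := mul_le_mul_of_nonneg_left (exp_le_one_add_add_two_mul_sq e1) hp0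
  have h2 := mul_le_mul_of_nonneg_left (exp_le_one_add_add_two_mul_sq e2) hq0
  have h3 : p * Real.exp (s * (1 - p)) + (1 - p) * Real.exp (-(s * p)) ≤
      Real.exp (2 * s ^ 2 * (p * (1 - p))) := by
    have h4 := Real.add_one_le_exp (2 * s ^ 2 * (p * (1 - p)))
    linarith
  rw [sum_binomPMF_mul_exp]
  calc (p * Real.exp (s * (1 - p)) + (1 - p) * Real.exp (-(s * p))) ^ n
      ≤ Real.exp (2 * s ^ 2 * (p * (1 - p))) ^ n := pow_le_pow_left₀ (by positivity) h3 n
    _ = Real.exp (2 * s ^ 2 * (p * (1 - p) * n)) := by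
      rw [← Real.exp_nat_mul]
      congr 1
      ring

theorem sum_binomPMF_mul_exp_sub_one_sq_le (n : ℕ) {p s : ℝ} (hp0 : 0 ≤ p) (hp1 : p ≤ 1)
    (hs : |s| ≤ 1) (hV : s ^ 2 * (p * (1 - p) * n) ≤ 1) :
    ∑ k ∈ Finset.range (n + 1), binomPMF n p k * (Real.exp (s * (k - n * p)) - 1) ^ 2 ≤
      8 * Real.exp 8 * (s ^ 2 * (p * (1 - p) * n)) := by
  have hq0 : 0 ≤ 1 - p := sub_nonneg.mpr hp1
  have h0 : ∑ k ∈ Finset.range (n + 1), binomPMF n p k * (Real.exp (s * (k - n * p)) - 1) ^ 2 =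
      ∑ k ∈ Finset.range (n + 1), binomPMF n p k * Real.exp (2 * s * (k - n * p)) -
        2 * ∑ k ∈ Finset.range (n + 1), binomPMF n p k * Real.exp (s * (k - n * p)) +
        ∑ k ∈ Finset.range (n + 1), binomPMF n p k := by
    rw [Finset.mul_sum, ← Finset.sum_sub_distrib, ← Finset.sum_add_distrib]
    refine Finset.sum_congr rfl fun k _ => ?_
    have : Real.exp (2 * s * (k - n * p)) = Real.exp (s * (k - n * p)) ^ 2 := by
      rw [← Real.exp_nat_mul]
      congr 1
      push_cast
      ring
    rw [this]
    ring
  have h1 := one_le_sum_binomPMF_mul_exp n hp0 hp1 s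
  have h2 := sum_binomPMF_mul_exp_le n (s := 2 * s) hp0 hp1 (by
    rw [abs_mul, abs_two]
    linarith)
  rw [h0, sum_binomPMF]
  have hv0 : 0 ≤ s ^ 2 * (p * (1 - p) * n) := by positivity
  have h3 : 2 * (2 * s) ^ 2 * (p * (1 - p) * n) = 8 * (s ^ 2 * (p * (1 - p) * n)) := by ring
  rw [h3] at h2
  set v := s ^ 2 * (p * (1 - p) * n)
  have h4 : Real.exp (8 * v) ≤ Real.exp 8 := Real.exp_le_exp.mpr (by linarith)
  have h5 : (1 - 8 * v) * Real.exp (8 * v) ≤ 1 := by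
    have h6 := mul_le_mul_of_nonneg_right (Real.add_one_le_exp (-(8 * v))) (Real.exp_pos (8 * v)).le
    rw [← Real.exp_add, neg_add_cancel, Real.exp_zero] at h6
    linarith
  have h7 : 8 * v * Real.exp (8 * v) ≤ 8 * v * Real.exp 8 :=
    mul_le_mul_of_nonneg_left h4 (by linarith)
  linarith

theorem expTail_eq_exp_max (lam t : ℝ) : expTail lam t = Real.exp (-(lam * max t 0)) := by
  unfold expTail
  split_ifs with h
  · simp [max_eq_right h]
  · rw [max_eq_left (not_le.mp h).le]

theorem expTail_le_one {lam : ℝ} (hl : 0 ≤ lam) (t : ℝ) : expTail lam t ≤ 1 := by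
  rw [expTail_eq_exp_max, Real.exp_le_one_iff]
  have := mul_nonneg hl (le_max_right t 0)
  linarith

theorem expTail_pos (lam t : ℝ) : 0 < expTail lam t := by
  rw [expTail_eq_exp_max]
  exact Real.exp_pos _

theorem expTail_le_mul_exp_abs {lam : ℝ} (hl : 0 ≤ lam) (t u : ℝ) :
    expTail lam t ≤ expTail lam u * Real.exp |lam * (t - u)| := by
  rw [expTail_eq_exp_max, expTail_eq_exp_max, ← Real.exp_add, Real.exp_le_exp, abs_mul,
    abs_of_nonneg hl]
  have h : max u 0 ≤ max t 0 + |t - u| := by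
    refine max_le ?_ ?_
    · have := neg_abs_le (t - u)
      have := le_max_left t 0
      linarith
    · have := le_max_right t 0
      have := abs_nonneg (t - u)
      linarith
  have := mul_le_mul_of_nonneg_left h hl
  linarith

theorem sq_exp_abs_sub_one_le (x : ℝ) :
    (Real.exp |x| - 1) ^ 2 ≤ (Real.exp x - 1) ^ 2 + (Real.exp (-x) - 1) ^ 2 := by
  rcases abs_cases x with ⟨h, _⟩ | ⟨h, _⟩ <;> rw [h]
  · linarith [sq_nonneg (Real.exp (-x) - 1)]
  · linarith [sq_nonneg (Real.exp x - 1)]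

theorem sq_expTail_sub_le {lam : ℝ} (hl : 0 ≤ lam) (t u : ℝ) :
    (expTail lam t - expTail lam u) ^ 2 ≤
      expTail lam u ^ 2 * (Real.exp |lam * (t - u)| - 1) ^ 2 := by
  have h1 := expTail_le_mul_exp_abs hl t u
  have h2 := expTail_le_mul_exp_abs hl u t
  rw [← neg_sub t u, mul_neg, abs_neg] at h2
  have hw : 1 ≤ Real.exp |lam * (t - u)| := Real.one_le_exp (abs_nonneg _)
  set w := Real.exp |lam * (t - u)|
  rw [← mul_pow]
  refine sq_le_sq' ?_ (by linarith)
  rcases le_total (expTail lam t) (expTail lam u) with h | h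
  · nlinarith
  · nlinarith [expTail_pos lam u]

theorem sum_binomPMF_mul_sq_expTail_sub_le (n : ℕ) {p lam : ℝ} (θ : ℝ) (hp0 : 0 ≤ p) (hp1 : p ≤ 1)
    (hl0 : 0 ≤ lam) (hl1 : lam ≤ 1) (hV : lam ^ 2 * (p * (1 - p) * n) ≤ 1) :
    ∑ k ∈ Finset.range (n + 1),
        binomPMF n p k * (expTail lam (θ * n - k) - expTail lam (θ * n - n * p)) ^ 2 ≤
      expTail lam (θ * n - n * p) ^ 2 *
        (16 * Real.exp 8 * (lam ^ 2 * (p * (1 - p) * n))) := by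
  have habs : |lam| ≤ 1 := by rwa [abs_of_nonneg hl0]
  have h1 := sum_binomPMF_mul_exp_sub_one_sq_le n hp0 hp1 habs hV
  have h2 := sum_binomPMF_mul_exp_sub_one_sq_le n (s := -lam) hp0 hp1 (by rwa [abs_neg])
    (by rwa [neg_sq])
  rw [neg_sq] at h2
  have h12 := mul_le_mul_of_nonneg_left (add_le_add h1 h2)
    (sq_nonneg (expTail lam (θ * n - n * p)))
  refine le_trans ?_ (h12.trans_eq (by ring))
  rw [← Finset.sum_add_distrib, Finset.mul_sum]
  refine Finset.sum_le_sum fun k _ => ?_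
  have h3 := (sq_expTail_sub_le hl0 (θ * n - k) (θ * n - n * p)).trans
    (mul_le_mul_of_nonneg_left (sq_exp_abs_sub_one_le _) (sq_nonneg _))
  have h4 := mul_le_mul_of_nonneg_left h3 (binomPMF_nonneg n hp0 hp1 k)
  have e1 : lam * (θ * n - k - (θ * n - n * p)) = -lam * (k - n * p) := by ring
  have e2 : -(-lam * (k - n * p)) = lam * (k - n * p) := by ring
  rw [e1, e2] at h4
  linarith

theorem expTail_mean_le_prAbove (n : ℕ) {p lam : ℝ} (θ : ℝ) (hp0 : 0 ≤ p) (hp1 : p ≤ 1)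
    (hl0 : 0 ≤ lam) (hl1 : lam ≤ 1) (hV : lam ^ 2 * (p * (1 - p) * n) ≤ 1) :
    expTail lam (θ * n - n * p) ≤ 2 * Real.exp 2 * prAbove n p θ lam := by
  have habs : |lam| ≤ 2 := by
    rw [abs_of_nonneg hl0]
    linarith
  have h1 := sum_binomPMF_mul_exp_le n hp0 hp1 habs
  have h2 := sum_binomPMF_mul_exp_le n (s := -lam) hp0 hp1 (by rwa [abs_neg])
  rw [neg_sq] at h2
  have h3 : Real.exp (2 * lam ^ 2 * (p * (1 - p) * n)) ≤ Real.exp 2 :=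
    Real.exp_le_exp.mpr (by linarith)
  set A := 2 * Real.exp 2 with hA
  have hA0 : 0 < A := by positivity
  set g := expTail lam (θ * n - n * p)
  have hg : 0 < g := expTail_pos _ _
  have hpt : ∀ k ∈ Finset.range (n + 1), g * (2 * A * binomPMF n p k -
      (binomPMF n p k * Real.exp (lam * (k - n * p)) +
        binomPMF n p k * Real.exp (-lam * (k - n * p)))) ≤
      A ^ 2 * (binomPMF n p k * expTail lam (θ * n - k)) := by
    intro k _
    have h4 := expTail_le_mul_exp_abs hl0 (θ * n - n * p) (θ * n - k)
    have e1 : lam * (θ * n - n * p - (θ * n - k)) = lam * (k - n * p) := by ring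
    rw [e1] at h4
    have h5 : Real.exp |lam * (k - n * p)| ≤
        Real.exp (lam * (k - n * p)) + Real.exp (-lam * (k - n * p)) := by
      rw [neg_mul]
      rcases abs_cases (lam * (k - n * p)) with ⟨h, _⟩ | ⟨h, _⟩ <;> rw [h]
      · linarith [Real.exp_pos (-(lam * (k - n * p)))]
      · linarith [Real.exp_pos (lam * (k - n * p))]
    have hw := Real.exp_pos |lam * (k - n * p)|
    set w := Real.exp |lam * (k - n * p)|
    set z := Real.exp (lam * (k - n * p)) + Real.exp (-lam * (k - n * p)) with hz
    have hv := expTail_pos lam (θ * n - k)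
    set e := expTail lam (θ * n - k)
    have h6 : g * (2 * A - z) ≤ A ^ 2 * e := by
      rcases le_total (2 * A) w with h | h
      · have : g * (2 * A - z) ≤ 0 := mul_nonpos_of_nonneg_of_nonpos hg.le (by linarith)
        nlinarith [mul_pos (pow_pos hA0 2) hv]
      · calc g * (2 * A - z) ≤ g * (2 * A - w) := mul_le_mul_of_nonneg_left (by linarith) hg.le
          _ ≤ e * w * (2 * A - w) := mul_le_mul_of_nonneg_right h4 (by linarith)
          _ ≤ A ^ 2 * e := by nlinarith [mul_nonneg hv.le (sq_nonneg (A - w))]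
    have h7 := mul_le_mul_of_nonneg_left h6 (binomPMF_nonneg n hp0 hp1 k)
    rw [hz] at h7
    linarith
  have hsum := Finset.sum_le_sum hpt
  rw [← Finset.mul_sum, ← Finset.mul_sum, Finset.sum_sub_distrib, Finset.sum_add_distrib,
    ← Finset.mul_sum, sum_binomPMF] at hsum
  change _ ≤ A ^ 2 * prAbove n p θ lam at hsum
  have h8 : g * A ≤ A ^ 2 * prAbove n p θ lam :=
    (mul_le_mul_of_nonneg_left (by linarith) hg.le).trans hsum
  refine le_of_mul_le_mul_right (a := A) ?_ hA0
  linarith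

/-- The KL-divergence is at most the `χ²`-divergence. -/
theorem sum_condPMF_mul_log_le (n : ℕ) {p lam : ℝ} (θ : ℝ) (hp0 : 0 ≤ p) (hp1 : p ≤ 1)
    (hl0 : 0 ≤ lam) (hb : prAbove n p θ lam < 1) :
    ∑ k ∈ Finset.range (n + 1),
        condPMF n p θ lam k * Real.log (condPMF n p θ lam k / binomPMF n p k) ≤
      (∑ k ∈ Finset.range (n + 1),
        binomPMF n p k * (expTail lam (θ * n - k) - prAbove n p θ lam) ^ 2) /
          (1 - prAbove n p θ lam) ^ 2 := by
  have hmean : ∑ k ∈ Finset.range (n + 1),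
      binomPMF n p k * (prAbove n p θ lam - expTail lam (θ * n - k)) = 0 := by
    simp_rw [mul_sub]
    rw [Finset.sum_sub_distrib, ← Finset.sum_mul, sum_binomPMF, one_mul]
    exact sub_self _
  set b := prAbove n p θ lam with hbdef
  have hb0 : 0 < 1 - b := by linarith
  have hne := hb0.ne'
  have hz : (∑ k ∈ Finset.range (n + 1), binomPMF n p k * (expTail lam (θ * n - k) - b) ^ 2) /
      (1 - b) ^ 2 = ∑ k ∈ Finset.range (n + 1), (binomPMF n p k *
        (expTail lam (θ * n - k) - b) ^ 2 / (1 - b) ^ 2 +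
          binomPMF n p k * (b - expTail lam (θ * n - k)) / (1 - b)) := by
    rw [Finset.sum_add_distrib, ← Finset.sum_div, ← Finset.sum_div, hmean, zero_div, add_zero]
  rw [hz]
  refine Finset.sum_le_sum fun k _ => ?_
  have hc : condPMF n p θ lam k =
      binomPMF n p k * ((1 - expTail lam (θ * n - k)) / (1 - b)) := mul_div_assoc _ _ _
  have hν := binomPMF_nonneg n hp0 hp1 k
  have hr : 0 ≤ (1 - expTail lam (θ * n - k)) / (1 - b) :=
    div_nonneg (sub_nonneg.mpr (expTail_le_one hl0 _)) hb0.le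
  have hR : binomPMF n p k * (expTail lam (θ * n - k) - b) ^ 2 / (1 - b) ^ 2 +
      binomPMF n p k * (b - expTail lam (θ * n - k)) / (1 - b) =
      binomPMF n p k * ((1 - expTail lam (θ * n - k)) / (1 - b)) *
        ((1 - expTail lam (θ * n - k)) / (1 - b) - 1) := by
    field_simp
    ring
  rw [hc, hR]
  set r := (1 - expTail lam (θ * n - k)) / (1 - b)
  rcases hν.eq_or_lt with h | h
  · simp [← h]
  rcases hr.eq_or_lt with h' | h'
  · simp [← h']
  rw [mul_div_cancel_left₀ _ h.ne']
  exact mul_le_mul_of_nonneg_left (Real.log_le_sub_one_of_pos h') (mul_nonneg hν hr)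

theorem sum_binomPMF_mul_sq_sub_prAbove_le (n : ℕ) (p θ lam c : ℝ) :
    ∑ k ∈ Finset.range (n + 1),
        binomPMF n p k * (expTail lam (θ * n - k) - prAbove n p θ lam) ^ 2 ≤
      ∑ k ∈ Finset.range (n + 1), binomPMF n p k * (expTail lam (θ * n - k) - c) ^ 2 := by
  have key : ∀ a : ℝ, ∑ k ∈ Finset.range (n + 1),
      binomPMF n p k * (expTail lam (θ * n - k) - a) ^ 2 =
      ∑ k ∈ Finset.range (n + 1), binomPMF n p k * expTail lam (θ * n - k) ^ 2 -
        2 * a * prAbove n p θ lam + a ^ 2 := by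
    intro a
    have h : a ^ 2 = ∑ k ∈ Finset.range (n + 1), a ^ 2 * binomPMF n p k := by
      rw [← Finset.mul_sum, sum_binomPMF, mul_one]
    rw [h, prAbove, Finset.mul_sum, ← Finset.sum_sub_distrib, ← Finset.sum_add_distrib]
    exact Finset.sum_congr rfl fun k _ => by ring
  rw [key, key]
  nlinarith [sq_nonneg (prAbove n p θ lam - c)]

/-- **KL-stable threshold reporting.**  Under the hypotheses of the χ²-stability theorem,
`d_KL((S ∣ ¬B), S) ≤ C · (Pr[B] · √(p(1−p)n) · λ)²` for a universal constant `C`. -/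
theorem kl_stable_threshold_reporting :
    ∃ C : ℝ, 0 < C ∧
      ∀ (n : ℕ) (p θ lam : ℝ),
        0 ≤ p → p ≤ 1 → 0 ≤ θ → θ ≤ 1 →
        0 < lam → lam ≤ 1 →
        lam * Real.sqrt (p * (1 - p) * n) ≤ 1 →
        prAbove n p θ lam < 1 / 4 →
        ∑ k ∈ Finset.range (n + 1),
            condPMF n p θ lam k * Real.log (condPMF n p θ lam k / binomPMF n p k)
          ≤ C * (prAbove n p θ lam * Real.sqrt (p * (1 - p) * n) * lam) ^ 2 := by
  refine ⟨128 * Real.exp 2 ^ 2 * Real.exp 8, by positivity, ?_⟩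
  intro n p θ lam hp0 hp1 _ _ hl0 hl1 hlV hb
  have hq0 : 0 ≤ 1 - p := sub_nonneg.mpr hp1
  have hVnn : 0 ≤ p * (1 - p) * n := by positivity
  have hsq : Real.sqrt (p * (1 - p) * n) ^ 2 = p * (1 - p) * n := Real.sq_sqrt hVnn
  have hV : lam ^ 2 * (p * (1 - p) * n) ≤ 1 := by
    rw [← hsq, ← mul_pow]
    exact pow_le_one₀ (by positivity) hlV
  have h1 := sum_condPMF_mul_log_le n θ hp0 hp1 hl0.le (by linarith)
  have h2 := sum_binomPMF_mul_sq_sub_prAbove_le n p θ lam (expTail lam (θ * n - n * p))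
  have h3 := sum_binomPMF_mul_sq_expTail_sub_le n θ hp0 hp1 hl0.le hl1 hV
  have h4 := expTail_mean_le_prAbove n θ hp0 hp1 hl0.le hl1 hV
  have h5 := pow_le_pow_left₀ (expTail_pos _ _).le h4 2
  have h6 := mul_le_mul_of_nonneg_right h5
    (show 0 ≤ 16 * Real.exp 8 * (lam ^ 2 * (p * (1 - p) * n)) by positivity)
  refine h1.trans ?_
  have hb2 : 9 / 16 ≤ (1 - prAbove n p θ lam) ^ 2 := by nlinarith
  have hexp : (prAbove n p θ lam * Real.sqrt (p * (1 - p) * n) * lam) ^ 2 =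
      prAbove n p θ lam ^ 2 * (lam ^ 2 * (p * (1 - p) * n)) := by
    rw [mul_pow, mul_pow, hsq]
    ring
  rw [hexp, div_le_iff₀ (by linarith)]
  refine (h2.trans (h3.trans h6)).trans ?_
  have hnn : 0 ≤ 128 * Real.exp 2 ^ 2 * Real.exp 8 *
      (prAbove n p θ lam ^ 2 * (lam ^ 2 * (p * (1 - p) * n))) := by positivity
  refine le_trans ?_ (mul_le_mul_of_nonneg_left hb2 hnn)
  linarith
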